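/- Let μ be symmetric and take c = 0 with masses M_0, …, M_{2r+1} ≥ 0. Suppose there is a strictly increasing function f: ℕ → ℝ with 2f(0)+1 > 0 such that for every k ≥ 0 there exist nonzero constants C_k, C'_k with lim_{n→∞} p_{2n}^{(2k)}(0)/((−1)^n n^{f(2k)}) = C_k and lim_{n→∞} p_{2n+1}^{(2k+1)}(0)/((−1)^n n^{f(2k+1)}) = C'_k. Then: (i) for every k with M_{2k} > 0 there is a nonzero constant D_k with lim_n n^{2f(2k)+1} · q_{2n}^{(2k)}(0)/p_{2n}^{(2k)}(0) = D_k, while for every other k ≥ 0 the ratio q_{2n}^{(2k)}(0)/p_{2n}^{(2k)}(0) converges to a nonzero constant; (ii) for every k with M_{2k+1} > 0 there is a nonzero constant D'_k with lim_n n^{2f(2k+1)+1} · q_{2n+1}^{(2k+1)}(0)/p_{2n+1}^{(2k+1)}(0) = D'_k, while for every other k ≥ 0 the ratio q_{2n+1}^{(2k+1)}(0)/p_{2n+1}^{(2k+1)}(0) converges to a nonzero constant. -/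

import Mathlib

open MeasureTheory Polynomial Filter Topology

noncomputable section

/-- The support of a Borel measure on `ℝ`. -/
def measSupport (μ : Measure ℝ) : Set ℝ := {x | ∀ U ∈ nhds x, μ U ≠ 0}

/-- `P` is a sequence of orthonormal polynomials with respect to the measure `μ`. -/
def IsOPS (μ : Measure ℝ) (P : ℕ → Polynomial ℝ) : Prop :=
  (∀ n, (P n).degree = n) ∧ (∀ n, 0 < (P n).leadingCoeff) ∧
    ∀ n m, (∫ x, (P n).eval x * (P m).eval x ∂μ) = if n = m then 1 else 0

/-- The discrete Sobolev inner product. -/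
def sobInner (μ : Measure ℝ) (c : ℝ) (r : ℕ) (M : ℕ → ℝ) (p q : Polynomial ℝ) : ℝ :=
  (∫ x, p.eval x * q.eval x ∂μ) +
    ∑ i ∈ Finset.range (r + 1),
      M i * (Polynomial.derivative^[i] p).eval c * (Polynomial.derivative^[i] q).eval c

/-- `Q` is the sequence of orthonormal polynomials for the Sobolev inner product. -/
def IsSobOPS (μ : Measure ℝ) (c : ℝ) (r : ℕ) (M : ℕ → ℝ) (Q : ℕ → Polynomial ℝ) : Prop :=
  (∀ n, (Q n).degree = n) ∧ (∀ n, 0 < (Q n).leadingCoeff) ∧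
    ∀ n m, sobInner μ c r M (Q n) (Q m) = if n = m then 1 else 0

theorem tendsto_rpow_succ_sub_div {s : ℝ} :
    Tendsto (fun n : ℕ => (((n : ℝ) + 1) ^ (s + 1) - (n : ℝ) ^ (s + 1)) / (n : ℝ) ^ s)
      atTop (𝓝 (s + 1)) := by
  have hd : HasDerivAt (fun x : ℝ => x ^ (s + 1)) (s + 1) 1 := by
    simpa using Real.hasDerivAt_rpow_const (x := 1) (p := s + 1) (Or.inl one_ne_zero)
  have h1 := hasDerivAt_iff_tendsto_slope_zero.1 hd
  have h2 : Tendsto (fun n : ℕ => ((n : ℝ))⁻¹) atTop (𝓝[≠] 0) := by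
    refine tendsto_nhdsWithin_iff.2 ⟨tendsto_inv_atTop_nhds_zero_nat, ?_⟩
    filter_upwards [eventually_ge_atTop 1] with n hn
    have : (n : ℝ) ≠ 0 := by positivity
    simpa using this
  refine (h1.comp h2).congr' ?_
  filter_upwards [eventually_ge_atTop 1] with n hn
  have hn' : (0 : ℝ) < n := by positivity
  have e : (n : ℝ) + 1 = n * (1 + (n : ℝ)⁻¹) := by field_simp
  have e2 : (0:ℝ) ≤ 1 + (n : ℝ)⁻¹ := by positivity
  rw [e, Real.mul_rpow hn'.le e2, Real.rpow_add_one hn'.ne' s]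
  simp only [Function.comp, smul_eq_mul, inv_inv, Real.one_rpow]
  have : (n : ℝ) ^ s ≠ 0 := by positivity
  field_simp

theorem tendsto_sum_range_div_rpow {b : ℕ → ℝ} {s L : ℝ} (hs : 0 < s + 1)
    (h : Tendsto (fun n : ℕ => b n / (n : ℝ) ^ s) atTop (𝓝 L)) :
    Tendsto (fun n : ℕ => (∑ j ∈ Finset.range n, b j) / (n : ℝ) ^ (s + 1)) atTop
      (𝓝 (L / (s + 1))) := by
  set d : ℕ → ℝ := fun n => ((n : ℝ) + 1) ^ (s + 1) - (n : ℝ) ^ (s + 1) with hd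
  have hdpos : ∀ n, 0 < d n := fun n =>
    sub_pos.2 (Real.rpow_lt_rpow n.cast_nonneg (lt_add_one _) hs)
  have hsum : ∀ n, ∑ j ∈ Finset.range n, d j = (n : ℝ) ^ (s + 1) := by
    intro n
    have := Finset.sum_range_sub (fun j : ℕ => (j : ℝ) ^ (s + 1)) n
    simpa [hd, Real.zero_rpow hs.ne'] using this
  have htop : Tendsto (fun n : ℕ => (n : ℝ) ^ (s + 1)) atTop atTop :=
    (tendsto_rpow_atTop hs).comp tendsto_natCast_atTop_atTop
  have hbd : Tendsto (fun n => b n / d n) atTop (𝓝 (L / (s + 1))) := by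
    refine (h.div tendsto_rpow_succ_sub_div hs.ne').congr' ?_
    filter_upwards [eventually_ge_atTop 1] with n hn
    have : (n : ℝ) ^ s ≠ 0 := by positivity
    have := (hdpos n).ne'
    simp only [hd, Pi.div_apply] at this ⊢
    field_simp
  have ho : (fun n => b n - L / (s + 1) * d n) =o[atTop] d := by
    refine (Asymptotics.isLittleO_iff_tendsto fun n hn => absurd hn (hdpos n).ne').2 ?_
    refine (tendsto_sub_nhds_zero_iff.2 hbd).congr fun n => ?_
    have := (hdpos n).ne'
    field_simp
  have hS := ho.sum_range (fun n => (hdpos n).le) (by simpa only [hsum] using htop)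
  simp only [Finset.sum_sub_distrib, ← Finset.mul_sum, hsum] at hS
  refine tendsto_sub_nhds_zero_iff.1 ((hS.tendsto_div_nhds_zero).congr' ?_)
  filter_upwards [eventually_ge_atTop 1] with n hn
  have : (n : ℝ) ^ (s + 1) ≠ 0 := by positivity
  field_simp

theorem degree_sum_mul_prod_erase_lt {ι : Type*} [DecidableEq ι] (I : Finset ι) (w e : ι → ℝ) :
    (∑ l ∈ I, C (w l) * ∏ m ∈ I.erase l, (X - C (e m))).degree < (I.card : WithBot ℕ) := by
  refine (degree_sum_le _ _).trans_lt ?_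
  rw [Finset.sup_lt_iff (WithBot.bot_lt_coe _)]
  intro l hl
  rw [degree_mul, degree_prod]
  refine (add_le_add_left degree_C_le _).trans_lt ?_
  simp only [degree_X_sub_C, Finset.sum_const, Finset.card_erase_of_mem hl, nsmul_eq_mul, mul_one,
    zero_add]
  have := Finset.card_pos.2 ⟨l, hl⟩
  exact_mod_cast Nat.sub_lt this one_pos

theorem eval_sum_mul_prod_erase_node {ι : Type*} [DecidableEq ι] {I : Finset ι} (w e : ι → ℝ)
    {k : ι} (hk : k ∈ I) :
    (∑ l ∈ I, C (w l) * ∏ m ∈ I.erase l, (X - C (e m))).eval (e k) =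
      w k * ∏ m ∈ I.erase k, (e k - e m) := by
  simp only [eval_finsetSum, eval_mul, eval_C, eval_prod, eval_sub, eval_X]
  refine Finset.sum_eq_single_of_mem k hk fun l _ hlk => ?_
  rw [Finset.prod_eq_zero (Finset.mem_erase.2 ⟨hlk.symm, hk⟩) (sub_self _), mul_zero]

theorem eval_sum_mul_prod_erase {ι : Type*} [DecidableEq ι] {I : Finset ι} (w e : ι → ℝ)
    {z : ℝ} (hz : ∀ l ∈ I, z - e l ≠ 0) :
    (∑ l ∈ I, C (w l) * ∏ m ∈ I.erase l, (X - C (e m))).eval z =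
      (∑ l ∈ I, w l / (z - e l)) * ∏ m ∈ I, (z - e m) := by
  simp only [eval_finsetSum, eval_mul, eval_C, eval_prod, eval_sub, eval_X, Finset.sum_mul]
  refine Finset.sum_congr rfl fun l hl => ?_
  rw [← Finset.mul_prod_erase I _ hl]
  have := hz l hl
  field_simp

theorem eq_zero_of_sum_div_sub_eq_zero {ι : Type*} [DecidableEq ι] {I : Finset ι}
    {w e g : ι → ℝ} (he : Set.InjOn e I) (hg : Set.InjOn g I)
    (hne : ∀ k ∈ I, ∀ l ∈ I, g k - e l ≠ 0)
    (h : ∀ k ∈ I, ∑ l ∈ I, w l / (g k - e l) = 0) : ∀ l ∈ I, w l = 0 := by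
  intro l hl
  have h0 := eq_zero_of_degree_lt_of_eval_index_eq_zero _ hg
    (degree_sum_mul_prod_erase_lt I w e)
    (fun k hk => by rw [eval_sum_mul_prod_erase w e (hne k hk), h k hk, zero_mul])
  have h1 := eval_sum_mul_prod_erase_node w e hl
  rw [h0, eval_zero] at h1
  refine (mul_eq_zero.1 h1.symm).resolve_right (Finset.prod_ne_zero_iff.2 fun m hm => ?_)
  rw [Finset.mem_erase] at hm
  exact sub_ne_zero.2 fun h => hm.1 (he hm.2 hl h.symm)

theorem exists_one_sub_sum_div_eq_prod {ι : Type*} [DecidableEq ι] {I : Finset ι}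
    {e g : ι → ℝ} (he : Set.InjOn e I) (hne : ∀ k ∈ I, ∀ l ∈ I, g k - e l ≠ 0) :
    ∃ x : ι → ℝ, (∀ l ∈ I, x l ≠ 0) ∧ ∀ z, (∀ l ∈ I, z - e l ≠ 0) →
      1 - ∑ l ∈ I, x l / (z - e l) = ∏ l ∈ I, (z - g l) / (z - e l) := by
  have hP : ∀ l ∈ I, ∏ m ∈ I.erase l, (e l - e m) ≠ 0 := fun l hl =>
    Finset.prod_ne_zero_iff.2 fun m hm => by
      rw [Finset.mem_erase] at hm
      exact sub_ne_zero.2 fun h => hm.1 (he hm.2 hl h.symm)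
  let x : ι → ℝ := fun l => -(∏ m ∈ I, (e l - g m)) / ∏ m ∈ I.erase l, (e l - e m)
  refine ⟨x, fun l hl => div_ne_zero (neg_ne_zero.2 (Finset.prod_ne_zero_iff.2 fun m hm => ?_))
    (hP l hl), fun z hz => ?_⟩
  · rw [← neg_ne_zero, neg_sub]
    exact hne m hm l hl
  have hdeg : (∏ m ∈ I, (X - C (e m)) - ∏ m ∈ I, (X - C (g m)) : ℝ[X]).degree <
      (I.card : WithBot ℕ) := by
    have h1 : ∀ v : ι → ℝ, (∏ m ∈ I, (X - C (v m)) : ℝ[X]).degree = I.card := fun v => by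
      simp [degree_prod]
    have h2 := degree_sub_lt_left ((h1 e).trans (h1 g).symm)
      (monic_prod_X_sub_C e I).ne_zero
      ((monic_prod_X_sub_C e I).leadingCoeff.trans (monic_prod_X_sub_C g I).leadingCoeff.symm)
    rwa [h1] at h2
  have h0 := eq_of_degrees_lt_of_eval_index_eq _ he hdeg
    (degree_sum_mul_prod_erase_lt I x e) (fun k hk => by
      rw [eval_sum_mul_prod_erase_node x e hk]
      simp only [x, eval_sub, eval_prod, eval_X, eval_C]
      rw [div_mul_cancel₀ _ (hP k hk), Finset.prod_eq_zero hk (sub_self _), zero_sub])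
  have h1 := congrArg (eval z) h0
  rw [eval_sum_mul_prod_erase x e hz] at h1
  simp only [eval_sub, eval_prod, eval_X, eval_C] at h1
  have h2 : ∏ m ∈ I, (z - e m) ≠ 0 := Finset.prod_ne_zero_iff.2 hz
  rw [Finset.prod_div_distrib, eq_div_iff h2, sub_mul, ← h1]
  ring

theorem tendsto_of_tendsto_matrix {ι : Type*} [Fintype ι] [DecidableEq ι]
    {A : ℕ → Matrix ι ι ℝ} {H : Matrix ι ι ℝ} {y b : ℕ → ι → ℝ} {x c : ι → ℝ}
    (hA : Tendsto A atTop (𝓝 H)) (hb : Tendsto b atTop (𝓝 c)) (hH : H.det ≠ 0)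
    (h : ∀ᶠ n in atTop, (A n).mulVec (y n) = b n) (hx : H.mulVec x = c) :
    Tendsto y atTop (𝓝 x) := by
  have key : ∀ (A : Matrix ι ι ℝ) (y b : ι → ℝ), A.mulVec y = b → A.det ≠ 0 →
      (A.det)⁻¹ • A.adjugate.mulVec b = y := by
    rintro A y b rfl hA
    rw [Matrix.mulVec_mulVec, Matrix.adjugate_mul, Matrix.smul_mulVec, Matrix.one_mulVec,
      smul_smul, inv_mul_cancel₀ hA, one_smul]
  have hdet : Tendsto (fun n => (A n).det) atTop (𝓝 H.det) := by
    have hc : Continuous fun B : Matrix ι ι ℝ => B.det := continuous_id.matrix_det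
    exact (hc.tendsto H).comp hA
  have hadj : Tendsto (fun n => (A n).adjugate) atTop (𝓝 H.adjugate) := by
    have hc : Continuous fun B : Matrix ι ι ℝ => B.adjugate := continuous_id.matrix_adjugate
    exact (hc.tendsto H).comp hA
  have hmul : ∀ i, Tendsto (fun n => (A n).det⁻¹ * ∑ j, (A n).adjugate i j * b n j) atTop
      (𝓝 (H.det⁻¹ * ∑ j, H.adjugate i j * c j)) := fun i =>
    (hdet.inv₀ hH).mul (tendsto_finsetSum _ fun j _ =>
      (tendsto_pi_nhds.1 (tendsto_pi_nhds.1 hadj i) j).mul (tendsto_pi_nhds.1 hb j))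
  refine tendsto_pi_nhds.2 fun i => ?_
  rw [← key H x c hx hH]
  refine (hmul i).congr' ?_
  filter_upwards [h, hdet.eventually_ne hH] with n hn hn'
  rw [← key _ _ _ hn hn']
  rfl

theorem tendsto_kernel_div_rpow {g : ℕ → ℝ} {c : ℕ → ℝ} {a : ℕ → ℕ → ℝ}
    (ha : ∀ k, Tendsto (fun n => a n k / ((-1 : ℝ) ^ n * (n : ℝ) ^ g k)) atTop (𝓝 (c k)))
    {k l : ℕ} (hkl : 0 < g k + g l + 1) :
    Tendsto (fun n : ℕ => (∑ j ∈ Finset.range n, a j k * a j l) / (n : ℝ) ^ (g k + g l + 1))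
      atTop (𝓝 (c k * c l / (g k + g l + 1))) := by
  refine tendsto_sum_range_div_rpow hkl (((ha k).mul (ha l)).congr' ?_)
  filter_upwards [eventually_ge_atTop 1] with n hn
  have hn' : (0 : ℝ) < n := by positivity
  have hsq : ((-1 : ℝ) ^ n) * (-1) ^ n = 1 := by rw [← mul_pow]; norm_num
  rw [div_mul_div_comm, mul_mul_mul_comm, hsq, one_mul, Real.rpow_add hn']

theorem exists_cauchy_solution {g c : ℕ → ℝ} (hg : Function.Injective g)
    (hpos : ∀ k, 0 < 2 * g k + 1) (hc : ∀ k, c k ≠ 0) (I : Finset ℕ) :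
    ∃ x : ℕ → ℝ, (∀ l ∈ I, x l ≠ 0) ∧
      (∀ k ∈ I, ∑ l ∈ I, x l * (c k * c l / (g k + g l + 1)) = c k) ∧
      ∀ k ∉ I, c k - ∑ l ∈ I, x l * (c k * c l / (g k + g l + 1)) ≠ 0 := by
  have hsub : ∀ k l, g k - -(g l + 1) = g k + g l + 1 := fun k l => by ring
  have hkl : ∀ k l, g k - -(g l + 1) ≠ 0 := fun k l => by
    rw [hsub]
    linarith [hpos k, hpos l]
  obtain ⟨x, hx, hF⟩ := exists_one_sub_sum_div_eq_prod (I := I) (e := fun l => -(g l + 1)) (g := g)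
    (fun l _ m _ h => hg (by simpa using h)) (fun k _ l _ => hkl k l)
  have hsum : ∀ k, c k - ∑ l ∈ I, x l / c l * (c k * c l / (g k + g l + 1)) =
      c k * ∏ l ∈ I, (g k - g l) / (g k - -(g l + 1)) := fun k => by
    rw [← hF _ fun l _ => hkl k l, mul_sub, mul_one, Finset.mul_sum]
    congr 1
    refine Finset.sum_congr rfl fun l _ => ?_
    have h1 := hkl k l
    rw [hsub] at h1 ⊢
    have := hc l
    field_simp
  refine ⟨fun l => x l / c l, fun l hl => div_ne_zero (hx l hl) (hc l), fun k hk => ?_,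
    fun k hk => ?_⟩
  · have := hsum k
    rw [Finset.prod_eq_zero hk (by simp), mul_zero] at this
    linarith
  · rw [hsum]
    refine mul_ne_zero (hc k) (Finset.prod_ne_zero_iff.2 fun l hl => div_ne_zero ?_ (hkl k l))
    exact sub_ne_zero.2 fun h => hk (hg h ▸ hl)

theorem det_cauchy_ne_zero {g c : ℕ → ℝ} (hg : Function.Injective g)
    (hpos : ∀ k, 0 < 2 * g k + 1) (hc : ∀ k, c k ≠ 0) (I : Finset ℕ) :
    (Matrix.of fun k l : I => c k * c l / (g k + g l + 1)).det ≠ 0 := by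
  intro h0
  obtain ⟨v, hv, hv0⟩ := Matrix.exists_mulVec_eq_zero_iff.2 h0
  refine hv (funext fun l => ?_)
  have hz := eq_zero_of_sum_div_sub_eq_zero (I := Finset.univ) (w := fun l : I => c l * v l)
    (e := fun l : I => -(g l + 1)) (g := fun l : I => g l)
    (fun l _ m _ h => Subtype.ext (hg (by simpa using h)))
    (fun l _ m _ h => Subtype.ext (hg h))
    (fun k _ l _ => by linarith [hpos k, hpos l]) (fun k _ => ?_) l (Finset.mem_univ l)
  · exact (mul_eq_zero.1 hz).resolve_left (hc l)
  · have h1 := congrFun hv0 k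
    simp only [Matrix.mulVec, dotProduct, Matrix.of_apply, Pi.zero_apply] at h1
    refine (mul_eq_zero.1 ?_).resolve_left (hc k)
    rw [Finset.mul_sum, ← h1]
    refine Finset.sum_congr rfl fun l _ => ?_
    have : g k - -(g l + 1) = g k + g l + 1 := by ring
    rw [this]
    ring

theorem ratio_asymptotics {g : ℕ → ℝ} (hg : Function.Injective g) (hpos : ∀ k, 0 < 2 * g k + 1)
    {c : ℕ → ℝ} (hc : ∀ k, c k ≠ 0) {a : ℕ → ℕ → ℝ}
    (ha : ∀ k, Tendsto (fun n => a n k / ((-1 : ℝ) ^ n * (n : ℝ) ^ g k)) atTop (𝓝 (c k)))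
    {I : Finset ℕ} {m : ℕ → ℝ} (hm : ∀ l ∈ I, 0 < m l) {u : ℕ → ℕ → ℝ} {α : ℕ → ℝ}
    (hα : ∀ n, 0 < α n)
    (hu : ∀ n k, u n k = α n * a n k -
      ∑ l ∈ I, m l * u n l * ∑ j ∈ Finset.range n, a j k * a j l)
    (hnorm : ∀ n, α n * (α n + ∑ l ∈ I, m l * u n l * a n l) = 1) :
    (∀ k ∈ I, ∃ D : ℝ, D ≠ 0 ∧
      Tendsto (fun n : ℕ => (n : ℝ) ^ (2 * g k + 1) * (u n k / a n k)) atTop (𝓝 D)) ∧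
    ∀ k ∉ I, ∃ D : ℝ, D ≠ 0 ∧ Tendsto (fun n : ℕ => u n k / a n k) atTop (𝓝 D) := by
  have hkl : ∀ k l, 0 < g k + g l + 1 := fun k l => by linarith [hpos k, hpos l]
  set s : ℕ → ℕ → ℝ := fun n k => (-1 : ℝ) ^ n * (n : ℝ) ^ g k with hs_def
  have hs : ∀ n : ℕ, 1 ≤ n → ∀ k, s n k ≠ 0 := fun n hn k => by
    have : (0 : ℝ) < n := by positivity
    exact mul_ne_zero (by simp) (by positivity)
  have hss : ∀ n : ℕ, 1 ≤ n → ∀ k l, (n : ℝ) ^ (g k + g l + 1) = s n k * s n l * n :=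
    fun n hn k l => by
      have hn' : (0 : ℝ) < n := by positivity
      have hsq : ((-1 : ℝ) ^ n) * (-1) ^ n = 1 := by rw [← mul_pow]; norm_num
      rw [Real.rpow_add_one hn'.ne', Real.rpow_add hn', hs_def]
      linear_combination (-(n : ℝ) ^ g k * (n : ℝ) ^ g l * n) * hsq
  set K : ℕ → ℕ → ℕ → ℝ := fun n k l =>
    (∑ j ∈ Finset.range n, a j k * a j l) / (n : ℝ) ^ (g k + g l + 1)
  have hK : ∀ k l, Tendsto (fun n => K n k l) atTop (𝓝 (c k * c l / (g k + g l + 1))) :=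
    fun k l => tendsto_kernel_div_rpow ha (hkl k l)
  set y : ℕ → ℕ → ℝ := fun n l => m l * u n l * s n l * n / α n
  have heq : ∀ n : ℕ, 1 ≤ n → ∀ k,
      u n k / (α n * s n k) = a n k / s n k - ∑ l ∈ I, y n l * K n k l := fun n hn k => by
    have hn' : (n : ℝ) ≠ 0 := by positivity
    have hαn := (hα n).ne'
    have hsk := hs n hn k
    rw [hu n k, sub_div, Finset.sum_div]
    congr 1
    · field_simp
    · refine Finset.sum_congr rfl fun l _ => ?_
      have hsl := hs n hn l
      simp only [y, K]
      rw [hss n hn]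
      field_simp
  obtain ⟨x, hx0, hxI, hxn⟩ := exists_cauchy_solution hg hpos hc I
  have hinv : ∀ k, Tendsto (fun n : ℕ => ((n : ℝ) ^ (g k + g k + 1))⁻¹) atTop (𝓝 0) := fun k =>
    ((tendsto_rpow_atTop (hkl k k)).comp tendsto_natCast_atTop_atTop).inv_tendsto_atTop
  have hy : ∀ l ∈ I, Tendsto (fun n => y n l) atTop (𝓝 (x l)) := by
    have hlim : Tendsto (fun n (l : I) => y n l) atTop (𝓝 fun l : I => x l) := by
      refine tendsto_of_tendsto_matrix
        (A := fun n => Matrix.of fun k l : I =>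
          K n k l + if k = l then (m k)⁻¹ * ((n : ℝ) ^ (g k + g k + 1))⁻¹ else 0)
        (H := Matrix.of fun k l : I => c k * c l / (g k + g l + 1))
        (b := fun n (k : I) => a n k / s n k) (c := fun k : I => c k) ?_ ?_
        (det_cauchy_ne_zero hg hpos hc I) ?_ ?_
      · refine tendsto_pi_nhds.2 fun k => tendsto_pi_nhds.2 fun l => ?_
        simp only [Matrix.of_apply]
        split_ifs
        · simpa using (hK k l).add ((hinv k).const_mul (m k)⁻¹)
        · simpa using hK k l
      · exact tendsto_pi_nhds.2 fun k => ha k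
      · filter_upwards [eventually_ge_atTop 1] with n hn
        ext k
        have hn' : (n : ℝ) ≠ 0 := by positivity
        have hαn := (hα n).ne'
        have hsk := hs n hn k
        have hmk := (hm k k.2).ne'
        have h1 := heq n hn k
        rw [← Finset.sum_coe_sort I fun l => y n l * K n k l] at h1
        simp only [Matrix.mulVec, dotProduct, Matrix.of_apply, add_mul, Finset.sum_add_distrib,
          ite_mul, zero_mul, Finset.sum_ite_eq, Finset.mem_univ, if_true]
        have h2 : (m k)⁻¹ * ((n : ℝ) ^ (g k + g k + 1))⁻¹ * y n k = u n k / (α n * s n k) := by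
          simp only [y]
          rw [hss n hn]
          field_simp
        rw [h2, h1]
        simp only [mul_comm (y n _)]
        ring
      · ext k
        rw [← hxI k k.2, ← Finset.sum_coe_sort I]
        simp only [Matrix.mulVec, dotProduct, Matrix.of_apply]
        exact Finset.sum_congr rfl fun l _ => mul_comm _ _
    exact fun l hl => tendsto_pi_nhds.1 hlim ⟨l, hl⟩
  have hα1 : Tendsto α atTop (𝓝 1) := by
    have he : Tendsto (fun n : ℕ => ∑ l ∈ I, y n l * (a n l / s n l) * (n : ℝ)⁻¹) atTop (𝓝 0) := by
      simpa using tendsto_finsetSum I fun l hl =>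
        ((hy l hl).mul (ha l)).mul tendsto_inv_atTop_nhds_zero_nat
    have h1 : Tendsto (fun n : ℕ => √(1 + ∑ l ∈ I, y n l * (a n l / s n l) * (n : ℝ)⁻¹)⁻¹) atTop
        (𝓝 1) := by
      simpa using ((he.const_add 1).inv₀ (by simp)).sqrt
    refine h1.congr' ?_
    filter_upwards [eventually_ge_atTop 1] with n hn
    have hn' : (n : ℝ) ≠ 0 := by positivity
    have hαn := (hα n).ne'
    have h2 : α n * ∑ l ∈ I, y n l * (a n l / s n l) * (n : ℝ)⁻¹ =
        ∑ l ∈ I, m l * u n l * a n l := by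
      rw [Finset.mul_sum]
      refine Finset.sum_congr rfl fun l _ => ?_
      have hsl := hs n hn l
      simp only [y]
      field_simp
    have h3 := hnorm n
    rw [← h2] at h3
    have h4 : (1 + ∑ l ∈ I, y n l * (a n l / s n l) * (n : ℝ)⁻¹)⁻¹ = α n ^ 2 := by
      refine inv_eq_of_mul_eq_one_right ?_
      linear_combination h3
    rw [h4, Real.sqrt_sq (hα n).le]
  have hane : ∀ k, ∀ᶠ n in atTop, a n k ≠ 0 := fun k =>
    ((ha k).eventually_ne (hc k)).mono fun n hn h0 => hn (by rw [h0, zero_div])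
  refine ⟨fun k hk => ⟨x k * 1 * (m k)⁻¹ * (c k)⁻¹, ?_, ?_⟩, fun k hk =>
    ⟨1 * (c k - ∑ l ∈ I, x l * (c k * c l / (g k + g l + 1))) * (c k)⁻¹, ?_, ?_⟩⟩
  · have := hx0 k hk
    have := (hm k hk).ne'
    have := hc k
    positivity
  · refine ((((hy k hk).mul hα1).mul_const _).mul ((ha k).inv₀ (hc k))).congr' ?_
    filter_upwards [eventually_ge_atTop 1, hane k] with n hn hak
    have hn' : (n : ℝ) ≠ 0 := by positivity
    have hαn := (hα n).ne'
    have hsk := hs n hn k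
    have hmk := (hm k hk).ne'
    rw [two_mul, hss n hn]
    simp only [y, hs_def] at hsk ⊢
    field_simp
  · exact mul_ne_zero (mul_ne_zero one_ne_zero (hxn k hk)) (inv_ne_zero (hc k))
  · refine ((hα1.mul ((ha k).sub (tendsto_finsetSum I fun l hl =>
      (hy l hl).mul (hK k l)))).mul ((ha k).inv₀ (hc k))).congr' ?_
    filter_upwards [eventually_ge_atTop 1, hane k] with n hn hak
    have hαn := (hα n).ne'
    have hsk := hs n hn k
    rw [← heq n hn k]
    simp only [hs_def] at hsk ⊢
    field_simp

theorem exists_eq_sum_of_degree_lt {P : ℕ → ℝ[X]} (hP : ∀ n, (P n).degree = n) (N : ℕ) (R : ℝ[X])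
    (hR : R.degree < N) : ∃ c : ℕ → ℝ, R = ∑ j ∈ Finset.range N, c j • P j := by
  induction N generalizing R with
  | zero => exact ⟨0, by simpa using hR⟩
  | succ N ih =>
    have hcoeff : (P N).coeff N ≠ 0 := coeff_ne_zero_of_eq_degree (hP N)
    set t := R.coeff N / (P N).coeff N with ht
    have hlt : (R - t • P N).degree < N := by
      rw [degree_lt_iff_coeff_zero]
      intro i hi
      rcases hi.eq_or_lt with rfl | hi
      · simp [ht, hcoeff]
      · have h1 : R.coeff i = 0 := (degree_lt_iff_coeff_zero _ _).1 hR i hi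
        have h2 : (P N).coeff i = 0 :=
          coeff_eq_zero_of_degree_lt (by rw [hP]; exact_mod_cast hi)
        simp [h1, h2]
    obtain ⟨c, hc⟩ := ih _ hlt
    refine ⟨fun j => if j = N then t else c j, ?_⟩
    simp only [Finset.sum_range_succ, if_true]
    rw [← sub_eq_iff_eq_add, hc]
    refine Finset.sum_congr rfl fun j hj => ?_
    rw [if_neg (Finset.mem_range.1 hj).ne]

theorem apply_eq_zero_of_degree_lt {B : ℝ[X] →ₗ[ℝ] ℝ[X] →ₗ[ℝ] ℝ} {P : ℕ → ℝ[X]}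
    (hP : ∀ n, (P n).degree = n) (hB : ∀ n m, B (P n) (P m) = if n = m then 1 else 0)
    {N : ℕ} {R : ℝ[X]} (hR : R.degree < N) : B (P N) R = 0 := by
  obtain ⟨c, rfl⟩ := exists_eq_sum_of_degree_lt hP N R hR
  rw [map_sum]
  refine Finset.sum_eq_zero fun j hj => ?_
  rw [map_smul, hB, if_neg (Finset.mem_range.1 hj).ne', smul_zero]

theorem eq_sum_apply_smul {B : ℝ[X] →ₗ[ℝ] ℝ[X] →ₗ[ℝ] ℝ} {P : ℕ → ℝ[X]}
    (hP : ∀ n, (P n).degree = n) (hB : ∀ n m, B (P n) (P m) = if n = m then 1 else 0)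
    {N : ℕ} {R : ℝ[X]} (hR : R.degree < N) :
    R = ∑ j ∈ Finset.range N, B R (P j) • P j := by
  obtain ⟨c, hc⟩ := exists_eq_sum_of_degree_lt hP N R hR
  have h : ∀ j ∈ Finset.range N, B R (P j) = c j := fun j hj => by
    rw [hc, map_sum, LinearMap.sum_apply, Finset.sum_eq_single_of_mem j hj]
    · simp [hB]
    · intro i _ hij
      simp [hB, hij]
  rw [Finset.sum_congr rfl fun j hj => by rw [h j hj]]
  exact hc

/-- The `k`-th derivative at the origin, as a linear functional on polynomials. -/
def derivAtZero (k : ℕ) : ℝ[X] →ₗ[ℝ] ℝ := leval 0 ∘ₗ derivative ^ k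

theorem derivAtZero_apply (k : ℕ) (P : ℝ[X]) :
    derivAtZero k P = (derivative^[k] P).eval 0 := by
  simp [derivAtZero, Module.End.pow_apply, leval]

theorem derivAtZero_eq_zero {k : ℕ} {P : ℝ[X]} (h : P.coeff k = 0) : derivAtZero k P = 0 := by
  rw [derivAtZero_apply, ← coeff_zero_eq_eval_zero, coeff_iterate_derivative]
  simp [h]

theorem integrable_eval_mul {μ : Measure ℝ} (hint : ∀ p : ℝ[X], Integrable (fun x => p.eval x) μ)
    (P Q : ℝ[X]) : Integrable (fun x => P.eval x * Q.eval x) μ := by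
  simpa using hint (P * Q)

/-- The inner product of `L²(μ)` as a bilinear form on polynomials. -/
def integralForm {μ : Measure ℝ} (hint : ∀ p : ℝ[X], Integrable (fun x => p.eval x) μ) :
    ℝ[X] →ₗ[ℝ] ℝ[X] →ₗ[ℝ] ℝ :=
  LinearMap.mk₂ ℝ (fun P Q => ∫ x, P.eval x * Q.eval x ∂μ)
    (fun P P' Q => by
      simp only [eval_add, add_mul]
      exact integral_add (integrable_eval_mul hint P Q) (integrable_eval_mul hint P' Q))
    (fun t P Q => by
      simp only [eval_smul, smul_eq_mul, mul_assoc]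
      exact integral_const_mul _ _)
    (fun P Q Q' => by
      simp only [eval_add, mul_add]
      exact integral_add (integrable_eval_mul hint P Q) (integrable_eval_mul hint P Q'))
    (fun t P Q => by
      simp only [eval_smul, smul_eq_mul, mul_left_comm _ t]
      exact integral_const_mul _ _)

theorem integralForm_apply {μ : Measure ℝ} (hint : ∀ p : ℝ[X], Integrable (fun x => p.eval x) μ)
    (P Q : ℝ[X]) : integralForm hint P Q = ∫ x, P.eval x * Q.eval x ∂μ :=
  rfl

theorem integralForm_comp_neg_X {μ : Measure ℝ}
    (hint : ∀ p : ℝ[X], Integrable (fun x => p.eval x) μ) (hsym : μ.map (fun x => -x) = μ)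
    (P Q : ℝ[X]) :
    integralForm hint (P.comp (-X)) Q = integralForm hint P (Q.comp (-X)) := by
  simp only [integralForm_apply, eval_comp, eval_neg, eval_X]
  conv_lhs => rw [← hsym]
  rw [integral_map measurable_neg.aemeasurable]
  · simp
  · exact Continuous.aestronglyMeasurable (by fun_prop)

theorem coeff_eq_zero_of_odd_add {μ : Measure ℝ}
    (hint : ∀ p : ℝ[X], Integrable (fun x => p.eval x) μ) (hsym : μ.map (fun x => -x) = μ)
    {p : ℕ → ℝ[X]} (hp : IsOPS μ p) {i j : ℕ} (hij : Odd (i + j)) : (p j).coeff i = 0 := by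
  have hcoeff : ∀ (R : ℝ[X]) i, (R.comp (-X)).coeff i = R.coeff i * (-1) ^ i := fun R i => by
    have h : (-X : ℝ[X]) = C (-1) * X := by simp
    rw [h, comp_C_mul_X_coeff]
  have hdeg : ∀ R : ℝ[X], ∀ N : ℕ, R.degree < N → (R.comp (-X)).degree < N := fun R N hR => by
    rw [degree_lt_iff_coeff_zero] at hR ⊢
    intro i hi
    rw [hcoeff, hR i hi, zero_mul]
  have hlt : ∀ n, (p n).degree < (n + 1 : ℕ) := fun n => by
    rw [hp.1]
    exact_mod_cast n.lt_succ_self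
  have horth : ∀ n m, integralForm hint (p n) (p m) = if n = m then 1 else 0 := hp.2.2
  have hexp := eq_sum_apply_smul hp.1 horth (hdeg _ _ (hlt j))
  rw [Finset.sum_range_succ, Finset.sum_eq_zero, zero_add] at hexp
  · set t := integralForm hint ((p j).comp (-X)) (p j)
    have hc : ∀ i, (p j).coeff i * (-1) ^ i = t * (p j).coeff i := fun i => by
      rw [← hcoeff, hexp, coeff_smul, smul_eq_mul]
    have hjj : (p j).coeff j ≠ 0 := coeff_ne_zero_of_eq_degree (hp.1 j)
    have ht : t = (-1) ^ j := mul_right_cancel₀ hjj (by rw [← hc, mul_comm])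
    have hi := hc i
    rw [ht] at hi
    have hsq : ((-1 : ℝ) ^ j) * (-1) ^ j = 1 := by rw [← mul_pow]; norm_num
    have hodd : ((-1 : ℝ) ^ i) * (-1) ^ j = -1 := by rw [← pow_add, hij.neg_one_pow]
    linear_combination (-1 : ℝ) / 2 * (-1) ^ j * hi - (p j).coeff i / 2 * hsq +
      (p j).coeff i / 2 * hodd
  · intro m hm
    rw [integralForm_comp_neg_X hint hsym, apply_eq_zero_of_degree_lt hp.1 horth, zero_smul]
    refine hdeg _ _ ?_
    rw [hp.1]
    exact_mod_cast Finset.mem_range.1 hm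

theorem derivAtZero_eq_zero_of_odd_add {μ : Measure ℝ}
    (hint : ∀ p : ℝ[X], Integrable (fun x => p.eval x) μ) (hsym : μ.map (fun x => -x) = μ)
    {p : ℕ → ℝ[X]} (hp : IsOPS μ p) {i j : ℕ} (hij : Odd (i + j)) : derivAtZero i (p j) = 0 :=
  derivAtZero_eq_zero (coeff_eq_zero_of_odd_add hint hsym hp hij)

/-- The discrete Sobolev inner product at the origin as a bilinear form on polynomials. -/
def sobForm {μ : Measure ℝ} (hint : ∀ p : ℝ[X], Integrable (fun x => p.eval x) μ)
    (s : ℕ) (M : ℕ → ℝ) : ℝ[X] →ₗ[ℝ] ℝ[X] →ₗ[ℝ] ℝ :=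
  integralForm hint +
    ∑ i ∈ Finset.range (s + 1), M i • (derivAtZero i).smulRight (derivAtZero i)

theorem sobForm_apply {μ : Measure ℝ} (hint : ∀ p : ℝ[X], Integrable (fun x => p.eval x) μ)
    (s : ℕ) (M : ℕ → ℝ) (P Q : ℝ[X]) :
    sobForm hint s M P Q = integralForm hint P Q +
      ∑ i ∈ Finset.range (s + 1), M i * derivAtZero i P * derivAtZero i Q := by
  simp [sobForm, mul_assoc]

theorem sobForm_eq_sobInner {μ : Measure ℝ}
    (hint : ∀ p : ℝ[X], Integrable (fun x => p.eval x) μ) (s : ℕ) (M : ℕ → ℝ) (P Q : ℝ[X]) :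
    sobForm hint s M P Q = sobInner μ 0 s M P Q := by
  rw [sobForm_apply]
  simp only [sobInner, derivAtZero_apply, integralForm_apply]

/-- The leading connection coefficient between the Sobolev and the standard orthonormal
polynomials. -/
theorem exists_connection {μ : Measure ℝ}
    (hint : ∀ p : ℝ[X], Integrable (fun x => p.eval x) μ) {s : ℕ} {M : ℕ → ℝ}
    {p q : ℕ → ℝ[X]} (hp : IsOPS μ p) (hq : IsSobOPS μ 0 s M q) (N : ℕ) :
    ∃ α : ℝ, 0 < α ∧
      (∀ k, derivAtZero k (q N) = α * derivAtZero k (p N) -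
        ∑ i ∈ Finset.range (s + 1), M i * derivAtZero i (q N) *
          ∑ j ∈ Finset.range N, derivAtZero k (p j) * derivAtZero i (p j)) ∧
      α * (α + ∑ i ∈ Finset.range (s + 1),
        M i * derivAtZero i (q N) * derivAtZero i (p N)) = 1 := by
  have hB : ∀ n m, integralForm hint (p n) (p m) = if n = m then 1 else 0 := hp.2.2
  have hS : ∀ n m, sobForm hint s M (q n) (q m) = if n = m then 1 else 0 := fun n m => by
    rw [sobForm_eq_sobInner]
    exact hq.2.2 n m
  have hlt : (q N).degree < (N + 1 : ℕ) := by
    rw [hq.1]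
    exact_mod_cast N.lt_succ_self
  have hexp := eq_sum_apply_smul hp.1 hB hlt
  rw [Finset.sum_range_succ] at hexp
  set α := integralForm hint (q N) (p N) with hα
  have hlow : (∑ j ∈ Finset.range N, integralForm hint (q N) (p j) • p j).degree < N := by
    refine (degree_sum_le _ _).trans_lt ((Finset.sup_lt_iff (WithBot.bot_lt_coe _)).2 ?_)
    intro j hj
    refine (degree_smul_le _ _).trans_lt ?_
    rw [hp.1]
    exact_mod_cast Finset.mem_range.1 hj
  have hj0 : ∀ j ∈ Finset.range N, integralForm hint (q N) (p j) =
      -∑ i ∈ Finset.range (s + 1), M i * derivAtZero i (q N) * derivAtZero i (p j) :=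
    fun j hj => by
      have h : sobForm hint s M (q N) (p j) = 0 := apply_eq_zero_of_degree_lt hq.1 hS (by
        rw [hp.1]
        exact_mod_cast Finset.mem_range.1 hj)
      rw [sobForm_apply] at h
      linarith
  refine ⟨α, ?_, fun k => ?_, ?_⟩
  · have hlead : (q N).leadingCoeff = α * (p N).leadingCoeff := by
      have h := congrArg (coeff · N) hexp
      simp only [coeff_add, coeff_smul, smul_eq_mul] at h
      rw [coeff_eq_zero_of_degree_lt hlow, zero_add] at h
      rwa [leadingCoeff, leadingCoeff, natDegree_eq_of_degree_eq_some (hq.1 N),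
        natDegree_eq_of_degree_eq_some (hp.1 N)]
    exact pos_of_mul_pos_left (hlead ▸ hq.2.1 N) (hp.2.1 N).le
  · have h := congrArg (derivAtZero k) hexp
    rw [map_add, map_sum, map_smul, smul_eq_mul] at h
    rw [h, add_comm, sub_eq_add_neg]
    congr 1
    simp only [Finset.mul_sum, map_smul, smul_eq_mul]
    rw [Finset.sum_comm, ← Finset.sum_neg_distrib]
    refine Finset.sum_congr rfl fun j hj => ?_
    rw [hj0 j hj, neg_mul, Finset.sum_mul]
    congr 1
    exact Finset.sum_congr rfl fun i _ => by ring
  · have h := congrArg (sobForm hint s M (q N)) hexp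
    rw [hS, if_pos rfl, map_add, apply_eq_zero_of_degree_lt hq.1 hS hlow, zero_add, map_smul,
      sobForm_apply, ← hα, smul_eq_mul] at h
    exact h.symm

theorem sum_range_two_mul_add {ε : ℕ} (hε : ε ≤ 1) {F : ℕ → ℝ}
    (hF : ∀ j, Odd (j + ε) → F j = 0) (n : ℕ) :
    ∑ j ∈ Finset.range (2 * n + ε), F j = ∑ j ∈ Finset.range n, F (2 * j + ε) := by
  induction n with
  | zero =>
    refine Finset.sum_eq_zero fun j hj => hF j ?_
    obtain rfl : j = 0 := by grind
    obtain rfl : ε = 1 := by grind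
    decide
  | succ n ih =>
    have h0 : F (2 * n + ε + 1) = 0 := hF _ (by grind)
    rw [show 2 * (n + 1) + ε = 2 * n + ε + 1 + 1 by ring, Finset.sum_range_succ,
      Finset.sum_range_succ, ih, Finset.sum_range_succ, h0, add_zero]

theorem sum_range_two_mul_eq {ε : ℕ} (hε : ε ≤ 1) {F : ℕ → ℝ}
    (hF : ∀ j, Odd (j + ε) → F j = 0) (n : ℕ) :
    ∑ j ∈ Finset.range (2 * n), F j = ∑ j ∈ Finset.range n, F (2 * j + ε) := by
  rw [← sum_range_two_mul_add hε hF]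
  interval_cases ε
  · rfl
  · rw [Finset.sum_range_succ, hF (2 * n) (by grind), add_zero]

theorem ratio_asymptotics_parity {μ : Measure ℝ}
    (hint : ∀ p : ℝ[X], Integrable (fun x => p.eval x) μ) (hsym : μ.map (fun x => -x) = μ)
    {r : ℕ} {M : ℕ → ℝ} (hM : ∀ i ≤ 2 * r + 1, 0 ≤ M i)
    {p q : ℕ → ℝ[X]} (hp : IsOPS μ p) (hq : IsSobOPS μ 0 (2 * r + 1) M q)
    {f : ℕ → ℝ} (hf : StrictMono f) (hf0 : 0 < 2 * f 0 + 1)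
    {ε : ℕ} (hε : ε ≤ 1) {c : ℕ → ℝ} (hc : ∀ k, c k ≠ 0)
    (hlim : ∀ k, Tendsto
      (fun n : ℕ => (derivative^[2 * k + ε] (p (2 * n + ε))).eval 0 /
          ((-1 : ℝ) ^ n * (n : ℝ) ^ (f (2 * k + ε)))) atTop (𝓝 (c k))) :
    (∀ k ≤ r, 0 < M (2 * k + ε) → ∃ D : ℝ, D ≠ 0 ∧ Tendsto
      (fun n : ℕ => (n : ℝ) ^ (2 * f (2 * k + ε) + 1) *
        ((derivative^[2 * k + ε] (q (2 * n + ε))).eval 0 /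
          (derivative^[2 * k + ε] (p (2 * n + ε))).eval 0)) atTop (𝓝 D)) ∧
    (∀ k : ℕ, (r < k ∨ M (2 * k + ε) = 0) → ∃ D : ℝ, D ≠ 0 ∧ Tendsto
      (fun n : ℕ => (derivative^[2 * k + ε] (q (2 * n + ε))).eval 0 /
          (derivative^[2 * k + ε] (p (2 * n + ε))).eval 0) atTop (𝓝 D)) := by
  have hodd : ∀ {i j : ℕ}, Odd (i + j) → derivAtZero i (p j) = 0 :=
    derivAtZero_eq_zero_of_odd_add hint hsym hp
  choose α hα hαu hαn using fun n => exists_connection hint hp hq (2 * n + ε)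
  have hmass : ∀ v : ℕ → ℝ, ∑ l ∈ Finset.range (r + 1) with M (2 * l + ε) ≠ 0,
      M (2 * l + ε) * v l = ∑ l ∈ Finset.range (r + 1), M (2 * l + ε) * v l := fun v =>
    Finset.sum_filter_of_ne fun l _ h h0 => h (by rw [h0, zero_mul])
  have key := ratio_asymptotics (g := fun k => f (2 * k + ε)) (c := c)
    (a := fun n k => derivAtZero (2 * k + ε) (p (2 * n + ε)))
    (u := fun n k => derivAtZero (2 * k + ε) (q (2 * n + ε)))
    (m := fun l => M (2 * l + ε)) (I := {l ∈ Finset.range (r + 1) | M (2 * l + ε) ≠ 0})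
    (α := α) (fun k l h => by simpa using hf.injective h)
    (fun k => by linarith [hf.monotone (Nat.zero_le (2 * k + ε))]) hc
    (by simpa only [derivAtZero_apply] using hlim)
    (fun l hl => by
      rw [Finset.mem_filter, Finset.mem_range] at hl
      exact (hM _ (by omega)).lt_of_ne hl.2.symm)
    hα
    (fun n k => by
      simp only [mul_assoc]
      rw [hαu n (2 * k + ε), hmass, show 2 * r + 1 + 1 = 2 * (r + 1) by ring,
        sum_range_two_mul_eq hε]
      · congr 1
        refine Finset.sum_congr rfl fun l _ => ?_
        rw [sum_range_two_mul_add hε, mul_assoc]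
        exact fun j hj => by rw [hodd (by grind), zero_mul]
      · intro i hi
        rw [Finset.sum_eq_zero, mul_zero]
        intro j _
        rcases Nat.even_or_odd (i + j) with h | h
        · rw [hodd (by grind), zero_mul]
        · rw [hodd h, mul_zero])
    (fun n => by
      rw [← hαn n]
      simp only [mul_assoc]
      rw [hmass, show 2 * r + 1 + 1 = 2 * (r + 1) by ring, sum_range_two_mul_eq hε]
      exact fun i hi => by rw [hodd (by grind), mul_zero, mul_zero])
  simp only [derivAtZero_apply] at key
  refine ⟨fun k hk hMk => key.1 k ?_, fun k hk => key.2 k ?_⟩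
  · rw [Finset.mem_filter, Finset.mem_range]
    exact ⟨by omega, hMk.ne'⟩
  · rw [Finset.mem_filter, Finset.mem_range]
    rintro ⟨h1, h2⟩
    exact hk.elim (fun h => by omega) h2

/-- **Lemma 3 (symmetric case).** With `μ` symmetric and masses `M_0,…,M_{2r+1}` at `c=0`,
if `p_{2n}^{(2k)}(0) ≅ C_k (-1)^n n^{f(2k)}` and `p_{2n+1}^{(2k+1)}(0) ≅ C'_k (-1)^n n^{f(2k+1)}`,
then the ratios `q_{2n}^{(2k)}(0)/p_{2n}^{(2k)}(0)` behave like `C n^{-(2f(2k)+1)}` if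
`M_{2k} > 0` and like a nonzero constant otherwise, and analogously for the odd case. -/
theorem symmetric_ratio_of_derivatives
    (μ : Measure ℝ) [IsFiniteMeasure μ]
    (hsupp : (measSupport μ).Infinite)
    (hint : ∀ p : Polynomial ℝ, Integrable (fun x => p.eval x) μ)
    (hsym : μ.map (fun x => -x) = μ)
    (r : ℕ) (M : ℕ → ℝ) (hM : ∀ i ≤ 2 * r + 1, 0 ≤ M i)
    (p : ℕ → Polynomial ℝ) (hp : IsOPS μ p)
    (q : ℕ → Polynomial ℝ) (hq : IsSobOPS μ 0 (2 * r + 1) M q)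
    (f : ℕ → ℝ) (hf : StrictMono f) (hf0 : 0 < 2 * f 0 + 1)
    (C C' : ℕ → ℝ) (hC : ∀ k, C k ≠ 0) (hC' : ∀ k, C' k ≠ 0)
    (hlimEven : ∀ k, Filter.Tendsto
      (fun n : ℕ =>
        (Polynomial.derivative^[2 * k] (p (2 * n))).eval 0 /
          ((-1 : ℝ) ^ n * (n : ℝ) ^ (f (2 * k))))
      Filter.atTop (nhds (C k)))
    (hlimOdd : ∀ k, Filter.Tendsto
      (fun n : ℕ =>
        (Polynomial.derivative^[2 * k + 1] (p (2 * n + 1))).eval 0 /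
          ((-1 : ℝ) ^ n * (n : ℝ) ^ (f (2 * k + 1))))
      Filter.atTop (nhds (C' k))) :
    ((∀ k ≤ r, 0 < M (2 * k) → ∃ D : ℝ, D ≠ 0 ∧ Filter.Tendsto
      (fun n : ℕ => (n : ℝ) ^ (2 * f (2 * k) + 1) *
        ((Polynomial.derivative^[2 * k] (q (2 * n))).eval 0 /
          (Polynomial.derivative^[2 * k] (p (2 * n))).eval 0))
      Filter.atTop (nhds D)) ∧
    (∀ k : ℕ, (r < k ∨ M (2 * k) = 0) → ∃ D : ℝ, D ≠ 0 ∧ Filter.Tendsto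
      (fun n : ℕ =>
        (Polynomial.derivative^[2 * k] (q (2 * n))).eval 0 /
          (Polynomial.derivative^[2 * k] (p (2 * n))).eval 0)
      Filter.atTop (nhds D))) ∧
    ((∀ k ≤ r, 0 < M (2 * k + 1) → ∃ D : ℝ, D ≠ 0 ∧ Filter.Tendsto
      (fun n : ℕ => (n : ℝ) ^ (2 * f (2 * k + 1) + 1) *
        ((Polynomial.derivative^[2 * k + 1] (q (2 * n + 1))).eval 0 /
          (Polynomial.derivative^[2 * k + 1] (p (2 * n + 1))).eval 0))
      Filter.atTop (nhds D)) ∧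
    (∀ k : ℕ, (r < k ∨ M (2 * k + 1) = 0) → ∃ D : ℝ, D ≠ 0 ∧ Filter.Tendsto
      (fun n : ℕ =>
        (Polynomial.derivative^[2 * k + 1] (q (2 * n + 1))).eval 0 /
          (Polynomial.derivative^[2 * k + 1] (p (2 * n + 1))).eval 0)
      Filter.atTop (nhds D))) := by
  exact ⟨ratio_asymptotics_parity hint hsym hM hp hq hf hf0 zero_le_one hC hlimEven,
    ratio_asymptotics_parity hint hsym hM hp hq hf hf0 le_rfl hC' hlimOdd⟩
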